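/- Let T₁, T₂ be two actions of G on ℝ-trees with dense minimal subtrees, such that C(T₁ × T₂) ≠ ∅. Then C is connected if and only if there is no twice-light rectangle (i.e. no two light quadrants facing each other). In this case, for every rectangle R = I₁ × I₂ ⊂ T₁ × T₂ (Iᵢ arcs of Tᵢ), the trace C ∩ R is either empty or connected. -/

import Mathlib

/-!
Formalization of definitions from V. Guirardel,
"Core and intersection number for group actions on trees".
-/

open Set Metric Filter Function Topology
open scoped ENNReal Pointwise

noncomputable section

namespace Guirardel

/-- The metric segment `[x,y]`: the set of points lying metrically between `x` and `y`.
In an `ℝ`-tree this is the image of the geodesic from `x` to `y`. -/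
def seg {T : Type*} [MetricSpace T] (x y : T) : Set T :=
  {p : T | dist x p + dist p y = dist x y}

/-- The open segment `]x,y[`. -/
def openSeg {T : Type*} [MetricSpace T] (x y : T) : Set T :=
  seg x y \ {x, y}

/-- A subset of an `ℝ`-tree is convex (i.e. a subtree when nonempty) if it contains the
segment between any two of its points. -/
def TreeConvex {T : Type*} [MetricSpace T] (S : Set T) : Prop :=
  ∀ x ∈ S, ∀ y ∈ S, seg x y ⊆ S

/-- An `ℝ`-tree: any two points are joined by a geodesic, and any two injective paths
with the same endpoints have the same image (uniqueness of arcs). -/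
structure IsRTree (T : Type*) [MetricSpace T] : Prop where
  exists_geod : ∀ x y : T, ∃ f : ℝ → T, f 0 = x ∧ f (dist x y) = y ∧
    ∀ s ∈ Icc (0 : ℝ) (dist x y), ∀ t ∈ Icc (0 : ℝ) (dist x y),
      dist (f s) (f t) = |s - t|
  arc_unique : ∀ (x y : T) (γ₁ γ₂ : Path x y),
    Function.Injective γ₁ → Function.Injective γ₂ →
      Set.range γ₁ = Set.range γ₂

/-- A direction based at `x`: a connected component of the complement of `x`. -/
def IsDirectionAt {T : Type*} [MetricSpace T] (δ : Set T) (x : T) : Prop :=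
  ∃ y : T, y ≠ x ∧ δ = connectedComponentIn {x}ᶜ y

/-- A direction in a tree. -/
def IsDirection {T : Type*} [MetricSpace T] (δ : Set T) : Prop :=
  ∃ x : T, IsDirectionAt δ x

/-- A branch point: a point with at least three directions. -/
def IsBranchPoint {T : Type*} [MetricSpace T] (x : T) : Prop :=
  ∃ δ₁ δ₂ δ₃ : Set T, IsDirectionAt δ₁ x ∧ IsDirectionAt δ₂ x ∧ IsDirectionAt δ₃ x ∧
    δ₁ ≠ δ₂ ∧ δ₁ ≠ δ₃ ∧ δ₂ ≠ δ₃

/-- A quadrant in `T₁ × T₂`: a product of two directions. -/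
def IsQuadrant {T₁ T₂ : Type*} [MetricSpace T₁] [MetricSpace T₂]
    (Q : Set (T₁ × T₂)) : Prop :=
  ∃ (δ₁ : Set T₁) (δ₂ : Set T₂), IsDirection δ₁ ∧ IsDirection δ₂ ∧ Q = δ₁ ×ˢ δ₂

/-- A quadrant is heavy if (for every choice of base point, which does not matter) there
is a sequence of orbit points inside it whose two coordinates go to infinity. -/
def Heavy (G : Type*) {T₁ T₂ : Type*} [Group G] [MetricSpace T₁] [MetricSpace T₂]
    [MulAction G T₁] [MulAction G T₂] (Q : Set (T₁ × T₂)) : Prop :=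
  ∀ p : T₁ × T₂, ∃ γ : ℕ → G,
    (∀ k, ((γ k • p.1 : T₁), (γ k • p.2 : T₂)) ∈ Q) ∧
    Tendsto (fun k => dist (γ k • p.1) p.1) atTop atTop ∧
    Tendsto (fun k => dist (γ k • p.2) p.2) atTop atTop

/-- The core of `T₁ × T₂`: the complement of the union of all light (i.e. non-heavy)
quadrants; equivalently the set of points all of whose quadrants are heavy. -/
def Core (G T₁ T₂ : Type*) [Group G] [MetricSpace T₁] [MetricSpace T₂]
    [MulAction G T₁] [MulAction G T₂] : Set (T₁ × T₂) :=
  {z : T₁ × T₂ | ∀ Q : Set (T₁ × T₂), IsQuadrant Q → z ∈ Q → Heavy G Q}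

/-- A subset of `T₁ × T₂` has convex fibers if its horizontal and vertical fibers
are convex. -/
def ConvexFibers {T₁ T₂ : Type*} [MetricSpace T₁] [MetricSpace T₂]
    (E : Set (T₁ × T₂)) : Prop :=
  (∀ x₁ : T₁, TreeConvex {y₂ : T₂ | (x₁, y₂) ∈ E}) ∧
  (∀ x₂ : T₂, TreeConvex {y₁ : T₁ | (y₁, x₂) ∈ E})

/-- The action of `G` on `T` is by isometries. -/
def IsometricAction (G T : Type*) [MetricSpace T] [SMul G T] : Prop :=
  ∀ (g : G) (x y : T), dist (g • x) (g • y) = dist x y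

/-- `g` is elliptic: it fixes a point of `T`. -/
def Elliptic {G : Type*} (T : Type*) [SMul G T] (g : G) : Prop :=
  ∃ x : T, g • x = x

/-- `g` is hyperbolic: it fixes no point of `T`. -/
def Hyperbolic {G : Type*} (T : Type*) [SMul G T] (g : G) : Prop :=
  ∀ x : T, g • x ≠ x

/-- Translation length of `g` on `T`. -/
def translationLength {G : Type*} (T : Type*) [MetricSpace T] [SMul G T] (g : G) : ℝ :=
  ⨅ x : T, dist x (g • x)

/-- The axis (characteristic set) of `g`: points minimizing displacement. -/
def axisSet {G : Type*} (T : Type*) [MetricSpace T] [SMul G T] (g : G) : Set T :=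
  {x : T | ∀ y : T, dist x (g • x) ≤ dist y (g • y)}

/-- The action is non-trivial: some element is hyperbolic. -/
def NontrivialAction (G T : Type*) [SMul G T] : Prop :=
  ∃ g : G, ∀ x : T, g • x ≠ x

/-- The action is free: only the identity fixes a point. -/
def FreeAction (G T : Type*) [Group G] [MulAction G T] : Prop :=
  ∀ g : G, g ≠ 1 → ∀ x : T, g • x ≠ x

/-- The action is minimal: no proper nonempty invariant subtree. -/
def MinimalAction (G T : Type*) [MetricSpace T] [SMul G T] : Prop :=
  ∀ S : Set T, S.Nonempty → TreeConvex S → (∀ g : G, ∀ x ∈ S, g • x ∈ S) → S = univ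

/-- The minimal subtree for the subset `H` of `G`: the intersection of all nonempty
invariant subtrees. -/
def minSubtreeOf {G : Type*} (H : Set G) (T : Type*) [MetricSpace T] [SMul G T] : Set T :=
  ⋂₀ {S : Set T | S.Nonempty ∧ TreeConvex S ∧ ∀ g ∈ H, ∀ x ∈ S, g • x ∈ S}

/-- The minimal subtree of the `G`-action. -/
def minSubtree (G T : Type*) [MetricSpace T] [SMul G T] : Set T :=
  minSubtreeOf (univ : Set G) T

/-- A line in `T`: the image of an isometric embedding of `ℝ`. -/
def IsLine {T : Type*} [MetricSpace T] (L : Set T) : Prop :=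
  ∃ f : ℝ → T, (∀ s t : ℝ, dist (f s) (f t) = |s - t|) ∧ L = range f

/-- A ray in `T`: the image of an isometric embedding of `[0,∞)`. -/
def IsRay {T : Type*} [MetricSpace T] (R : Set T) : Prop :=
  ∃ f : ℝ → T, (∀ s ∈ Ici (0 : ℝ), ∀ t ∈ Ici (0 : ℝ), dist (f s) (f t) = |s - t|) ∧
    R = f '' Ici 0

/-- Two rays (or subsets) define the same end when they are at finite Hausdorff distance. -/
def SameEnd {T : Type*} [MetricSpace T] (R R' : Set T) : Prop :=
  EMetric.hausdorffEdist R R' ≠ ⊤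

/-- The action of `G` fixes an end of `T`. -/
def GFixedEnd (G T : Type*) [MetricSpace T] [SMul G T] : Prop :=
  ∃ R : Set T, IsRay R ∧ ∀ g : G, SameEnd ((fun x => g • x) '' R) R

/-- The action of `G` has an invariant line. -/
def GInvariantLine (G T : Type*) [MetricSpace T] [SMul G T] : Prop :=
  ∃ L : Set T, IsLine L ∧ ∀ g : G, (fun x => g • x) '' L = L

/-- The action is irreducible: no invariant line and no fixed end. -/
def IrreducibleAction (G T : Type*) [MetricSpace T] [SMul G T] : Prop :=
  ¬ GInvariantLine G T ∧ ¬ GFixedEnd G T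

/-- The action is dihedral: there is an invariant line on which some element acts as a
reflection (i.e. with non-constant displacement along the line). -/
def DihedralAction (G T : Type*) [MetricSpace T] [SMul G T] : Prop :=
  ∃ L : Set T, IsLine L ∧ (∀ g : G, (fun x => g • x) '' L = L) ∧
    ∃ g : G, ∃ x ∈ L, ∃ y ∈ L, dist x (g • x) ≠ dist y (g • y)

/-- `A` is a positive semi-axis of `g`: a ray contained in the axis of `g` and mapped
into itself by `g`. -/
def PosSemiAxis {G : Type*} (T : Type*) [MetricSpace T] [SMul G T] (g : G) (A : Set T) :
    Prop :=
  IsRay A ∧ A ⊆ axisSet T g ∧ (fun x => g • x) '' A ⊆ A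

/-- `g` translates towards the end determined by the ray `R`:
`g` is hyperbolic and has a positive semi-axis defining the same end as `R`. -/
def TranslatesToward {G : Type*} (T : Type*) [MetricSpace T] [SMul G T] (g : G)
    (R : Set T) : Prop :=
  Hyperbolic T g ∧ ∃ A : Set T, PosSemiAxis T g A ∧ SameEnd A R

/-- The end `ω_T(g)` of the hyperbolic element `g` lies in the set of ends of `δ`:
some positive semi-axis of `g` is contained in `δ`. -/
def EndInSubtree {G : Type*} (T : Type*) [MetricSpace T] [SMul G T] (g : G)
    (δ : Set T) : Prop :=
  ∃ A : Set T, PosSemiAxis T g A ∧ A ⊆ δ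

/-- A map between `ℝ`-trees preserves alignment if the image of a point between `y`
and `z` lies between the images of `y` and `z`. -/
def AlignPreserving {T T' : Type*} [MetricSpace T] [MetricSpace T'] (f : T → T') : Prop :=
  ∀ x y z : T, x ∈ seg y z → f x ∈ seg (f y) (f z)

/-- `f : T → T'` witnesses that `T` is a refinement of `T'`: it is an equivariant
continuous surjection preserving alignment. -/
def IsRefinementMap (G : Type*) {T T' : Type*} [Group G] [MetricSpace T] [MetricSpace T']
    [MulAction G T] [MulAction G T'] (f : T → T') : Prop :=
  Continuous f ∧ Surjective f ∧ AlignPreserving f ∧ ∀ (g : G) (x : T), f (g • x) = g • f x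

/-- The length functions of the two actions are homothetic. -/
def HomotheticLengths (G T₁ T₂ : Type*) [MetricSpace T₁] [MetricSpace T₂] [SMul G T₁]
    [SMul G T₂] : Prop :=
  ∃ c : ℝ, 0 < c ∧ ∀ g : G, translationLength T₁ g = c * translationLength T₂ g

/-- A bundled `ℝ`-tree with an isometric action of `G`. -/
structure GTree (G : Type*) [Group G] where
  carrier : Type
  [ms : MetricSpace carrier]
  [ma : MulAction G carrier]
  isom : ∀ (g : G) (x y : carrier), dist (g • x) (g • y) = dist x y
  tree : IsRTree carrier

attribute [instance] GTree.ms GTree.ma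

/-- A simplicial structure on an `ℝ`-tree: a vertex set containing all branch points,
meeting every segment in a finite set, and discrete. -/
def IsSimplicialStructure {T : Type*} [MetricSpace T] (V : Set T) : Prop :=
  (∀ x : T, IsBranchPoint x → x ∈ V) ∧
  (∀ x y : T, (seg x y ∩ V).Finite) ∧
  (∀ v ∈ V, ∃ ε > 0, ∀ w ∈ V, dist v w < ε → w = v)

/-- Two vertices of a simplicial tree are adjacent (span an edge). -/
def Adjacent {T : Type*} [MetricSpace T] (V : Set T) (v w : T) : Prop :=
  v ∈ V ∧ w ∈ V ∧ v ≠ w ∧ seg v w ∩ V = {v, w}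

/-- A bundled simplicial `G`-tree. -/
structure SimplicialGTree (G : Type*) [Group G] extends GTree G where
  V : Set carrier
  simp : IsSimplicialStructure V
  inv : ∀ g : G, (fun x => g • x) '' V = V

/-- `T₁` and `T₂` are refinements of a common non-trivial simplicial action of `G`. -/
def RefineCommonSimplicial (G T₁ T₂ : Type*) [Group G] [MetricSpace T₁] [MetricSpace T₂]
    [MulAction G T₁] [MulAction G T₂] : Prop :=
  ∃ T' : SimplicialGTree G, NontrivialAction G T'.carrier ∧
    (∃ f₁ : T₁ → T'.carrier, IsRefinementMap G f₁) ∧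
    (∃ f₂ : T₂ → T'.carrier, IsRefinementMap G f₂)

/-- Two directions face each other: their union is the whole tree. -/
def FacingDirections {T : Type*} [MetricSpace T] (δ δ' : Set T) : Prop :=
  δ ∪ δ' = univ

/-- There is a twice-light rectangle with (opposite) base corners `x` and `x'`:
two light quadrants based at `x` and `x'` facing each other. -/
def IsTwiceLightRect (G : Type*) {T₁ T₂ : Type*} [Group G] [MetricSpace T₁]
    [MetricSpace T₂] [MulAction G T₁] [MulAction G T₂] (x x' : T₁ × T₂) : Prop :=
  ∃ (δ₁ : Set T₁) (δ₂ : Set T₂) (δ₁' : Set T₁) (δ₂' : Set T₂),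
    IsDirectionAt δ₁ x.1 ∧ IsDirectionAt δ₂ x.2 ∧
    IsDirectionAt δ₁' x'.1 ∧ IsDirectionAt δ₂' x'.2 ∧
    x.1 ≠ x'.1 ∧ x.2 ≠ x'.2 ∧
    FacingDirections δ₁ δ₁' ∧ FacingDirections δ₂ δ₂' ∧
    ¬ Heavy G (δ₁ ×ˢ δ₂) ∧ ¬ Heavy G (δ₁' ×ˢ δ₂')

/-- The open rectangle with opposite corners `x, x'`. -/
def openRect {T₁ T₂ : Type*} [MetricSpace T₁] [MetricSpace T₂] (x x' : T₁ × T₂) :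
    Set (T₁ × T₂) :=
  openSeg x.1 x'.1 ×ˢ openSeg x.2 x'.2

/-- A maximal twice-light rectangle. -/
def IsMaxTwiceLightRect (G : Type*) {T₁ T₂ : Type*} [Group G] [MetricSpace T₁]
    [MetricSpace T₂] [MulAction G T₁] [MulAction G T₂] (x x' : T₁ × T₂) : Prop :=
  IsTwiceLightRect G x x' ∧ ∀ y y' : T₁ × T₂, IsTwiceLightRect G y y' →
    openRect x x' ⊆ openRect y y' → openRect x x' = openRect y y'

/-- The straight diagonal of a rectangle joining the two opposite corners `p` and `q`. -/
def mainDiag {T₁ T₂ : Type*} [MetricSpace T₁] [MetricSpace T₂] (p q : T₁ × T₂) :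
    Set (T₁ × T₂) :=
  {z : T₁ × T₂ | z.1 ∈ seg p.1 q.1 ∧ z.2 ∈ seg p.2 q.2 ∧
    dist p.1 z.1 * dist p.2 q.2 = dist p.2 z.2 * dist p.1 q.1}

/-- The augmented core: the union of the core and of the main diagonals of the maximal
twice-light rectangles (the diagonals joining the two opposite corners lying in the core). -/
def AugCore (G T₁ T₂ : Type*) [Group G] [MetricSpace T₁] [MetricSpace T₂]
    [MulAction G T₁] [MulAction G T₂] : Set (T₁ × T₂) :=
  Core G T₁ T₂ ∪
    {z : T₁ × T₂ | ∃ x x' p q : T₁ × T₂, IsMaxTwiceLightRect G x x' ∧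
      p ∈ Core G T₁ T₂ ∧ q ∈ Core G T₁ T₂ ∧
      ({p.1, q.1} : Set T₁) = {x.1, x'.1} ∧ ({p.2, q.2} : Set T₂) = {x.2, x'.2} ∧
      p.1 ≠ q.1 ∧ p.2 ≠ q.2 ∧ z ∈ mainDiag p q}

/-- There exists an equivariant (strong) deformation retraction of `T₁ × T₂` onto `C`. -/
def EquivDeformRetract (G : Type*) {T₁ T₂ : Type*} [Group G] [MetricSpace T₁]
    [MetricSpace T₂] [MulAction G T₁] [MulAction G T₂] (C : Set (T₁ × T₂)) : Prop :=
  ∃ H : ℝ → T₁ × T₂ → T₁ × T₂,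
    Continuous (fun p : ℝ × (T₁ × T₂) => H p.1 p.2) ∧
    (∀ z : T₁ × T₂, H 0 z = z) ∧
    (∀ z : T₁ × T₂, H 1 z ∈ C) ∧
    (∀ t : ℝ, ∀ z ∈ C, H t z = z) ∧
    (∀ (t : ℝ) (g : G) (z : T₁ × T₂), H t (g • z) = g • H t z)

/-- The `ℓ²` product distance on `T₁ × T₂`. -/
def dist2 {T₁ T₂ : Type*} [MetricSpace T₁] [MetricSpace T₂] (p q : T₁ × T₂) : ℝ :=
  Real.sqrt (dist p.1 q.1 ^ 2 + dist p.2 q.2 ^ 2)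

/-- The length of a path `c : [0,1] → T₁ × T₂`, measured with the `ℓ²` product metric. -/
def pathLen2 {T₁ T₂ : Type*} [MetricSpace T₁] [MetricSpace T₂] (c : ℝ → T₁ × T₂) :
    ℝ≥0∞ :=
  ⨆ (n : ℕ) (u : Fin (n + 1) → ℝ) (_ : Monotone u) (_ : ∀ i, u i ∈ Icc (0 : ℝ) 1),
    ∑ i : Fin n, ENNReal.ofReal (dist2 (c (u i.castSucc)) (c (u i.succ)))

/-- The path metric induced on a subset `C ⊆ T₁ × T₂` by the `ℓ²` product metric. -/
def pathDistOn {T₁ T₂ : Type*} [MetricSpace T₁] [MetricSpace T₂] (C : Set (T₁ × T₂))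
    (x y : C) : ℝ :=
  (⨅ (c : ℝ → T₁ × T₂) (_ : ContinuousOn c (Icc (0 : ℝ) 1))
      (_ : MapsTo c (Icc (0 : ℝ) 1) C) (_ : c 0 = (x : T₁ × T₂))
      (_ : c 1 = (y : T₁ × T₂)), pathLen2 c).toReal

/-- A distance function makes a set a CAT(0) space: it is a metric, geodesic, and the
CN-inequality of Bruhat–Tits holds (comparison triangles are at least as thick). -/
structure IsCAT0Dist {X : Type*} (d : X → X → ℝ) : Prop where
  refl : ∀ x, d x x = 0
  symm : ∀ x y, d x y = d y x
  triangle : ∀ x y z, d x z ≤ d x y + d y z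
  eq_of_dist_eq_zero : ∀ x y, d x y = 0 → x = y
  geodesic : ∀ x y, ∃ f : ℝ → X, f 0 = x ∧ f (d x y) = y ∧
    ∀ s ∈ Icc (0 : ℝ) (d x y), ∀ t ∈ Icc (0 : ℝ) (d x y), d (f s) (f t) = |s - t|
  cn : ∀ x y z m, d y m = d y z / 2 → d m z = d y z / 2 →
    d x m ^ 2 ≤ (d x y ^ 2 + d x z ^ 2) / 2 - d y z ^ 2 / 4

/-- A 2-cell of the core of a product of two simplicial trees: a rectangle which is a
product of two edges and is contained in the core. -/
def IsCoreCell (G : Type*) {T₁ T₂ : Type*} [Group G] [MetricSpace T₁] [MetricSpace T₂]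
    [MulAction G T₁] [MulAction G T₂] (V₁ : Set T₁) (V₂ : Set T₂)
    (R : Set (T₁ × T₂)) : Prop :=
  ∃ v₁ w₁ v₂ w₂, Adjacent V₁ v₁ w₁ ∧ Adjacent V₂ v₂ w₂ ∧
    R = seg v₁ w₁ ×ˢ seg v₂ w₂ ∧ R ⊆ Core G T₁ T₂


section RTree

variable {T : Type*} [MetricSpace T]

theorem left_mem_seg (x y : T) : x ∈ seg x y := by simp [seg]

theorem right_mem_seg (x y : T) : y ∈ seg x y := by simp [seg]

theorem seg_comm (x y : T) : seg x y = seg y x := by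
  ext p
  simp only [seg, mem_ofPred_eq]
  rw [add_comm, dist_comm y p, dist_comm p x, dist_comm y x]

theorem seg_subset_seg_left {x y p : T} (hp : p ∈ seg x y) : seg x p ⊆ seg x y := by
  intro q hq
  simp only [seg, mem_ofPred_eq] at *
  linarith [dist_triangle q p y, dist_triangle x q y]

theorem seg_subset_seg_right {x y p : T} (hp : p ∈ seg x y) : seg p y ⊆ seg x y := by
  rw [seg_comm p, seg_comm x]
  exact seg_subset_seg_left (by rwa [seg_comm])

/-- Distinct points of an `ℝ`-tree are joined by an injective path inside the segment, along
which the distance to the initial point is monotone. -/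
theorem IsRTree.exists_path (hT : IsRTree T) {x y : T} (hxy : x ≠ y) :
    ∃ γ : Path x y, Injective γ ∧ range γ ⊆ seg x y ∧ Monotone fun t => dist x (γ t) := by
  obtain ⟨f, f0, f1, hf⟩ := hT.exists_geod x y
  have hd : 0 < dist x y := dist_pos.2 hxy
  have hmem (t : unitInterval) : dist x y * t ∈ Icc (0 : ℝ) (dist x y) :=
    ⟨mul_nonneg hd.le t.2.1, mul_le_of_le_one_right hd.le t.2.2⟩
  have hg (s t : unitInterval) :
      dist (f (dist x y * s)) (f (dist x y * t)) = dist x y * dist s t := by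
    rw [hf _ (hmem s) _ (hmem t), ← mul_sub, abs_mul, abs_of_pos hd]
    rfl
  have hcont : Continuous fun t : unitInterval => f (dist x y * t) :=
    (LipschitzWith.of_dist_le_mul (K := ⟨dist x y, hd.le⟩) fun s t => (hg s t).le).continuous
  refine ⟨⟨⟨fun t => f (dist x y * t), hcont⟩, by simpa using f0, by simpa using f1⟩, ?_, ?_, ?_⟩
  · intro s t hst
    have h := hg s t
    rw [show f (dist x y * s) = f (dist x y * t) from hst, dist_self] at h
    exact dist_eq_zero.1 ((mul_eq_zero.1 h.symm).resolve_left hd.ne')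
  · rintro _ ⟨t, rfl⟩
    have h0 := hf 0 ⟨le_rfl, hd.le⟩ _ (hmem t)
    have h1 := hf _ (hmem t) _ ⟨hd.le, le_rfl⟩
    rw [f0, zero_sub, abs_neg, abs_of_nonneg (hmem t).1] at h0
    rw [f1, abs_of_nonpos (sub_nonpos.2 (hmem t).2)] at h1
    change dist x (f (dist x y * t)) + dist (f (dist x y * t)) y = dist x y
    linarith
  · intro s t hst
    change dist x (f (dist x y * s)) ≤ dist x (f (dist x y * t))
    rw [← f0, hf 0 ⟨le_rfl, hd.le⟩ _ (f0.symm ▸ hmem s), hf 0 ⟨le_rfl, hd.le⟩ _ (f0.symm ▸ hmem t),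
      zero_sub, zero_sub, abs_neg, abs_neg, f0, abs_of_nonneg (hmem s).1,
      abs_of_nonneg (hmem t).1]
    exact mul_le_mul_of_nonneg_left hst hd.le

theorem injective_path_trans {x m y : T} {γ : Path x m} {γ' : Path m y}
    (hγ : Injective γ) (hγ' : Injective γ') (h : range γ ∩ range γ' ⊆ {m}) :
    Injective (γ.trans γ') := by
  have key (s t : unitInterval) (hs : (s : ℝ) ≤ 1 / 2) (ht : ¬ (t : ℝ) ≤ 1 / 2) :
      γ.trans γ' s ≠ γ.trans γ' t := by
    intro hst
    rw [Path.trans_apply, Path.trans_apply, dif_pos hs, dif_neg ht] at hst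
    have hm : γ' _ = m := h ⟨⟨_, hst⟩, mem_range_self _⟩
    have h0 := hγ' (hm.trans γ'.source.symm)
    rw [Subtype.ext_iff] at h0
    apply ht
    simp only [Icc.coe_zero] at h0
    linarith
  intro s t hst
  by_cases hs : (s : ℝ) ≤ 1 / 2 <;> by_cases ht : (t : ℝ) ≤ 1 / 2
  · rw [Path.trans_apply, Path.trans_apply, dif_pos hs, dif_pos ht] at hst
    have h0 := hγ hst
    rw [Subtype.ext_iff] at h0
    exact Subtype.ext (by simpa using h0)
  · exact absurd hst (key s t hs ht)
  · exact absurd hst.symm (key t s ht hs)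
  · rw [Path.trans_apply, Path.trans_apply, dif_neg hs, dif_neg ht] at hst
    have h0 := hγ' hst
    rw [Subtype.ext_iff] at h0
    exact Subtype.ext (by simpa using h0)

theorem IsRTree.seg_subset_range (hT : IsRTree T) {x y : T} (γ : Path x y)
    (hγ : Injective γ) : seg x y ⊆ range γ := by
  intro p hp
  by_cases hx : x = p
  · exact ⟨0, by simp [hx]⟩
  by_cases hy : p = y
  · exact ⟨1, by simp [hy]⟩
  obtain ⟨γ₁, hγ₁, hr₁, -⟩ := hT.exists_path hx
  obtain ⟨γ₂, hγ₂, hr₂, -⟩ := hT.exists_path hy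
  have hinj : Injective (γ₁.trans γ₂) := by
    refine injective_path_trans hγ₁ hγ₂ ?_
    rintro q ⟨h₁, h₂⟩
    have h₁ := hr₁ h₁
    have h₂ := hr₂ h₂
    simp only [seg, mem_ofPred_eq] at h₁ h₂ hp
    refine dist_le_zero.1 ?_
    linarith [dist_triangle x q y, dist_comm p q]
  rw [hT.arc_unique x y γ _ hγ hinj, Path.trans_range]
  exact Or.inl ⟨1, γ₁.target⟩

theorem IsRTree.isCompact_seg (hT : IsRTree T) (x y : T) : IsCompact (seg x y) := by
  rcases eq_or_ne x y with rfl | hxy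
  · convert isCompact_singleton (x := x)
    ext p
    simp [seg, dist_comm p x, eq_comm (a := x)]
  · obtain ⟨γ, hγ, hr, -⟩ := hT.exists_path hxy
    rw [(hT.seg_subset_range γ hγ).antisymm hr]
    exact isCompact_range γ.continuous

theorem IsRTree.isPreconnected_seg (hT : IsRTree T) (x y : T) : IsPreconnected (seg x y) := by
  rcases eq_or_ne x y with rfl | hxy
  · convert isPreconnected_singleton (x := x)
    ext p
    simp [seg, dist_comm p x, eq_comm (a := x)]
  · obtain ⟨γ, hγ, hr, -⟩ := hT.exists_path hxy
    rw [(hT.seg_subset_range γ hγ).antisymm hr]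
    exact isPreconnected_range γ.continuous

theorem TreeConvex.isPreconnected (hT : IsRTree T) {S : Set T} (hS : TreeConvex S) :
    IsPreconnected S :=
  isPreconnected_of_forall_pair fun x hx y hy =>
    ⟨seg x y, hS x hx y hy, left_mem_seg x y, right_mem_seg x y, hT.isPreconnected_seg x y⟩

/-- Geodesic triangles in an `ℝ`-tree are tripods: each side lies in the union of the
other two. -/
theorem IsRTree.seg_subset_union (hT : IsRTree T) (x y z : T) :
    seg x y ⊆ seg x z ∪ seg z y := by
  rcases eq_or_ne x z with rfl | hxz
  · exact subset_union_right
  obtain ⟨γ, hγ, hr, hmono⟩ := hT.exists_path hxz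
  set K : Set unitInterval := γ ⁻¹' seg z y with hK
  have hKc : IsCompact K :=
    ((hT.isCompact_seg z y).isClosed.preimage γ.continuous).isCompact
  obtain ⟨t, htK, ht⟩ := hKc.exists_isLeast ⟨1, by simp [hK, left_mem_seg]⟩
  have hm : γ t ∈ seg x z := hr (mem_range_self t)
  by_cases hx : x = γ t
  · exact (hx ▸ seg_subset_seg_right htK : seg x y ⊆ seg z y).trans subset_union_right
  by_cases hy : γ t = y
  · exact (hy ▸ seg_subset_seg_left hm : seg x y ⊆ seg x z).trans subset_union_left
  obtain ⟨γ₁, hγ₁, hr₁, -⟩ := hT.exists_path hx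
  obtain ⟨γ₂, hγ₂, hr₂, -⟩ := hT.exists_path hy
  have hinj : Injective (γ₁.trans γ₂) := by
    refine injective_path_trans hγ₁ hγ₂ ?_
    rintro q ⟨h₁, h₂⟩
    have h₁ := hr₁ h₁
    obtain ⟨s, rfl⟩ := hT.seg_subset_range γ hγ (seg_subset_seg_left hm h₁)
    have hs : dist x (γ t) ≤ dist x (γ s) := hmono (ht (seg_subset_seg_right htK (hr₂ h₂)))
    simp only [seg, mem_ofPred_eq] at h₁
    exact dist_le_zero.1 (by linarith)
  refine (hT.seg_subset_range _ hinj).trans ?_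
  rw [Path.trans_range]
  exact union_subset_union (hr₁.trans (seg_subset_seg_left hm))
    (hr₂.trans (seg_subset_seg_right htK))

theorem IsRTree.treeConvex_seg (hT : IsRTree T) (a b : T) : TreeConvex (seg a b) := by
  intro x hx y hy
  refine (hT.seg_subset_union x y a).trans (union_subset ?_ (seg_subset_seg_left hy))
  rw [seg_comm]
  exact seg_subset_seg_left hx

theorem IsDirectionAt.notMem {δ : Set T} {x : T} (h : IsDirectionAt δ x) : x ∉ δ := by
  obtain ⟨y, -, rfl⟩ := h
  exact fun hx => connectedComponentIn_subset _ _ hx rfl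

theorem IsDirection.nonempty {δ : Set T} (h : IsDirection δ) : δ.Nonempty := by
  obtain ⟨x, y, hy, rfl⟩ := h
  exact ⟨y, mem_connectedComponentIn hy⟩

theorem IsDirectionAt.mem_of_notMem_seg (hT : IsRTree T) {δ : Set T} {x w z : T}
    (h : IsDirectionAt δ x) (hw : w ∈ δ) (hx : x ∉ seg w z) : z ∈ δ := by
  obtain ⟨y, -, rfl⟩ := h
  rw [connectedComponentIn_eq hw]
  refine (hT.isPreconnected_seg w z).subset_connectedComponentIn (left_mem_seg w z) ?_
    (right_mem_seg w z)
  rintro _ hp rfl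
  exact hx hp

theorem IsDirection.isOpen (hT : IsRTree T) {δ : Set T} (h : IsDirection δ) : IsOpen δ := by
  obtain ⟨x, h⟩ := h
  refine Metric.isOpen_iff.2 fun w hw =>
    ⟨dist w x, dist_pos.2 (ne_of_mem_of_not_mem hw h.notMem), fun z hz => ?_⟩
  refine h.mem_of_notMem_seg hT hw fun hx => ?_
  rw [mem_ball, dist_comm] at hz
  simp only [seg, mem_ofPred_eq] at hx
  linarith [dist_nonneg (x := x) (y := z)]

theorem IsDirection.treeConvex_compl (hT : IsRTree T) {δ : Set T} (h : IsDirection δ) :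
    TreeConvex δᶜ := by
  obtain ⟨x, h⟩ := h
  intro a ha b hb w hw hwδ
  have hwa : x ∈ seg w a := by_contra fun hx => ha (h.mem_of_notMem_seg hT hwδ hx)
  have hwb : x ∈ seg w b := by_contra fun hx => hb (h.mem_of_notMem_seg hT hwδ hx)
  refine ne_of_mem_of_not_mem hwδ h.notMem (dist_le_zero.1 ?_)
  simp only [seg, mem_ofPred_eq] at hw hwa hwb
  linarith [dist_triangle a x b, dist_comm a x, dist_comm a w]

/-- Two overlapping directions which omit opposite endpoints of a segment through a common
point face each other. -/
theorem facingDirections_of_mem_seg (hT : IsRTree T) {δ δ' : Set T} {p a b : T}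
    (hδ : IsDirection δ) (hδ' : IsDirection δ') (hp : p ∈ δ) (hp' : p ∈ δ')
    (hab : p ∈ seg a b) (ha : a ∉ δ) (hb : b ∉ δ') : FacingDirections δ δ' := by
  refine eq_univ_of_forall fun z => ?_
  by_contra hz
  rw [mem_union, not_or] at hz
  rcases hT.seg_subset_union a b z hab with h | h
  · exact hδ.treeConvex_compl hT a ha z hz.1 h hp
  · exact hδ'.treeConvex_compl hT z hz.2 b hb h hp'

theorem FacingDirections.ne {δ δ' : Set T} {x x' : T} (h : FacingDirections δ δ')
    (hδ : IsDirectionAt δ x) (hδ' : IsDirectionAt δ' x') : x ≠ x' := by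
  rintro rfl
  exact (h.symm ▸ mem_univ x : x ∈ δ ∪ δ').elim hδ.notMem hδ'.notMem

end RTree

section Action

variable {G T : Type*} [Group G] [MetricSpace T] [MulAction G T]

theorem IsDirection.smul (hiso : IsometricAction G T) (g : G) {δ : Set T}
    (h : IsDirection δ) : IsDirection (g • δ) := by
  obtain ⟨x, y, hy, rfl⟩ := h
  have : IsIsometricSMul G T := ⟨fun c => Isometry.of_dist_eq (hiso c)⟩
  refine ⟨g • x, g • y, fun h => hy (MulAction.injective g h), ?_⟩
  have := (Homeomorph.smul (α := T) g).image_connectedComponentIn (s := {x}ᶜ) (x := y) hy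
  rw [image_compl_eq (Homeomorph.smul (α := T) g).bijective, image_singleton] at this
  exact this

theorem smul_mem_seg (hiso : IsometricAction G T) (g : G) {x y p : T} (hp : p ∈ seg x y) :
    g • p ∈ seg (g • x) (g • y) := by
  simpa only [seg, mem_ofPred_eq, hiso g] using hp

/-- When the minimal subtree is dense, every orbit meets every direction. -/
theorem exists_smul_mem_direction (hT : IsRTree T) (hiso : IsometricAction G T)
    (hdense : Dense (minSubtree G T)) {δ : Set T} (hδ : IsDirection δ) (x : T) :
    ∃ g : G, g • x ∈ δ := by
  by_contra! hx
  obtain ⟨z, hz, hzm⟩ := hdense.inter_open_nonempty δ (hδ.isOpen hT) hδ.nonempty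
  have hS : z ∈ {w : T | ∀ g : G, g • w ∈ δᶜ} := by
    refine hzm _ ⟨⟨x, hx⟩, ?_, ?_⟩
    · exact fun a ha b hb w hw g =>
        hδ.treeConvex_compl hT _ (ha g) _ (hb g) (smul_mem_seg hiso g hw)
    · intro g _ w hw k
      rw [← mul_smul]
      exact hw _
  exact (one_smul G z ▸ hS 1 : z ∈ δᶜ) hz

end Action

section Core

variable {G T₁ T₂ : Type*} [Group G] [MetricSpace T₁] [MetricSpace T₂]
  [MulAction G T₁] [MulAction G T₂]

theorem tendsto_dist_mul_smul {T : Type*} [MetricSpace T] [MulAction G T]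
    (hiso : IsometricAction G T) (g : G) {γ : ℕ → G} {p : T}
    (h : Tendsto (fun k => dist (γ k • p) p) atTop atTop) :
    Tendsto (fun k => dist ((g * γ k) • p) p) atTop atTop := by
  refine tendsto_atTop_mono (fun k => ?_) (tendsto_atTop_add_const_right _ (-dist (g • p) p) h)
  rw [mul_smul]
  have h₁ := dist_triangle_right (g • γ k • p) (g • p) p
  linarith [hiso g (γ k • p) p]

theorem Heavy.smul (hiso₁ : IsometricAction G T₁) (hiso₂ : IsometricAction G T₂) (g : G)
    {Q : Set (T₁ × T₂)} (h : Heavy G Q) : Heavy G (g • Q) := by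
  intro p
  obtain ⟨γ, hQ, h₁, h₂⟩ := h p
  refine ⟨fun k => g * γ k, fun k => ⟨_, hQ k, ?_⟩, tendsto_dist_mul_smul hiso₁ g h₁,
    tendsto_dist_mul_smul hiso₂ g h₂⟩
  simp [mul_smul]

theorem smul_mem_core (hiso₁ : IsometricAction G T₁) (hiso₂ : IsometricAction G T₂) (g : G)
    {z : T₁ × T₂} (hz : z ∈ Core G T₁ T₂) : g • z ∈ Core G T₁ T₂ := by
  rintro _ ⟨δ₁, δ₂, h₁, h₂, rfl⟩ hzQ
  have hQ : g⁻¹ • (δ₁ ×ˢ δ₂ : Set (T₁ × T₂)) = (g⁻¹ • δ₁) ×ˢ (g⁻¹ • δ₂) := by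
    ext w
    simp only [mem_inv_smul_set_iff, mem_prod, Prod.smul_fst, Prod.smul_snd]
  have := hz _ ⟨_, _, h₁.smul hiso₁ g⁻¹, h₂.smul hiso₂ g⁻¹, hQ⟩ (mem_inv_smul_set_iff.2 hzQ)
  simpa using this.smul hiso₁ hiso₂ g

theorem notMem_core_iff {z : T₁ × T₂} : z ∉ Core G T₁ T₂ ↔
    ∃ (δ₁ : Set T₁) (δ₂ : Set T₂), IsDirection δ₁ ∧ IsDirection δ₂ ∧
      z.1 ∈ δ₁ ∧ z.2 ∈ δ₂ ∧ ¬ Heavy G (δ₁ ×ˢ δ₂) := by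
  constructor
  · intro h
    simp only [Core, mem_ofPred_eq, not_forall] at h
    obtain ⟨_, ⟨δ₁, δ₂, h₁, h₂, rfl⟩, hz, hQ⟩ := h
    exact ⟨δ₁, δ₂, h₁, h₂, hz.1, hz.2, hQ⟩
  · rintro ⟨δ₁, δ₂, h₁, h₂, hz₁, hz₂, hQ⟩ h
    exact hQ (h _ ⟨δ₁, δ₂, h₁, h₂, rfl⟩ ⟨hz₁, hz₂⟩)

theorem not_mem_direction_of_mem_core {δ₁ : Set T₁} {δ₂ : Set T₂} (h₁ : IsDirection δ₁)
    (h₂ : IsDirection δ₂) (hQ : ¬ Heavy G (δ₁ ×ˢ δ₂)) {x : T₁} {y : T₂}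
    (hC : (x, y) ∈ Core G T₁ T₂) : ¬ (x ∈ δ₁ ∧ y ∈ δ₂) :=
  fun h => hQ (hC _ ⟨δ₁, δ₂, h₁, h₂, rfl⟩ h)

theorem isClosed_core (hT₁ : IsRTree T₁) (hT₂ : IsRTree T₂) : IsClosed (Core G T₁ T₂) := by
  rw [← isOpen_compl_iff, isOpen_iff_forall_mem_open]
  intro z hz
  obtain ⟨δ₁, δ₂, h₁, h₂, hz₁, hz₂, hQ⟩ := notMem_core_iff.1 hz
  exact ⟨δ₁ ×ˢ δ₂, fun w hw => notMem_core_iff.2 ⟨δ₁, δ₂, h₁, h₂, hw.1, hw.2, hQ⟩,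
    (h₁.isOpen hT₁).prod (h₂.isOpen hT₂), hz₁, hz₂⟩

theorem treeConvex_core_fiber (hT₁ : IsRTree T₁) (y : T₂) :
    TreeConvex {x : T₁ | (x, y) ∈ Core G T₁ T₂} := by
  intro a ha b hb w hw
  by_contra hwC
  obtain ⟨δ₁, δ₂, h₁, h₂, hz₁, hz₂, hQ⟩ := notMem_core_iff.1 hwC
  exact h₁.treeConvex_compl hT₁
    a (fun h => not_mem_direction_of_mem_core h₁ h₂ hQ ha ⟨h, hz₂⟩)
    b (fun h => not_mem_direction_of_mem_core h₁ h₂ hQ hb ⟨h, hz₂⟩) hw hz₁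

theorem not_isPreconnected_core_of_twiceLight (hT₁ : IsRTree T₁)
    (hiso₁ : IsometricAction G T₁) (hiso₂ : IsometricAction G T₂)
    (hdense₁ : Dense (minSubtree G T₁)) (hne : (Core G T₁ T₂).Nonempty)
    {x x' : T₁ × T₂} (h : IsTwiceLightRect G x x') : ¬ IsPreconnected (Core G T₁ T₂) := by
  obtain ⟨δ₁, δ₂, δ₁', δ₂', h₁, h₂, h₁', h₂', -, -, hf₁, hf₂, hQ, hQ'⟩ := h
  have h₁ : IsDirection δ₁ := ⟨_, h₁⟩
  have h₂ : IsDirection δ₂ := ⟨_, h₂⟩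
  have h₁' : IsDirection δ₁' := ⟨_, h₁'⟩
  have h₂' : IsDirection δ₂' := ⟨_, h₂'⟩
  obtain ⟨z, hz⟩ := hne
  obtain ⟨g, hg⟩ := exists_smul_mem_direction hT₁ hiso₁ hdense₁ h₁ z.1
  obtain ⟨g', hg'⟩ := exists_smul_mem_direction hT₁ hiso₁ hdense₁ h₁' z.1
  have hf₁ (a : T₁) : a ∈ δ₁ ∨ a ∈ δ₁' := (hf₁.symm ▸ mem_univ a : a ∈ δ₁ ∪ δ₁')
  have hf₂ (b : T₂) : b ∈ δ₂ ∨ b ∈ δ₂' := (hf₂.symm ▸ mem_univ b : b ∈ δ₂ ∪ δ₂')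
  intro hpre
  obtain ⟨w, hw, hw₁, hw₂⟩ := hpre (Prod.fst ⁻¹' δ₁) (Prod.fst ⁻¹' δ₁')
    ((h₁.isOpen hT₁).preimage continuous_fst) ((h₁'.isOpen hT₁).preimage continuous_fst)
    (fun w _ => hf₁ w.1) ⟨g • z, smul_mem_core hiso₁ hiso₂ g hz, hg⟩
    ⟨g' • z, smul_mem_core hiso₁ hiso₂ g' hz, hg'⟩
  rcases hf₂ w.2 with hb | hb
  · exact not_mem_direction_of_mem_core h₁ h₂ hQ hw ⟨hw₁, hb⟩
  · exact not_mem_direction_of_mem_core h₁' h₂' hQ' hw ⟨hw₂, hb⟩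

/-- Without twice-light rectangles, the projection of the trace of the core on a strip
`seg a b × T₂` is convex. -/
theorem treeConvex_snd_core (hT₁ : IsRTree T₁) (hT₂ : IsRTree T₂)
    (h : ¬ ∃ x x' : T₁ × T₂, IsTwiceLightRect G x x') (a b : T₁) :
    TreeConvex {y : T₂ | ∃ x ∈ seg a b, (x, y) ∈ Core G T₁ T₂} := by
  rintro y₀ ⟨c₀, hc₀, hC₀⟩ y₁ ⟨c₁, hc₁, hC₁⟩ y hy
  by_contra hyY
  let U (v : T₂) : Set T₁ := ⋃₀ {δ₁ | IsDirection δ₁ ∧ ∃ δ₂, IsDirection δ₂ ∧ y ∈ δ₂ ∧ v ∈ δ₂ ∧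
    ¬ Heavy G (δ₁ ×ˢ δ₂)}
  have hU (v : T₂) : IsOpen (U v) := isOpen_sUnion fun δ hδ => hδ.1.isOpen hT₁
  have hcover : seg c₀ c₁ ⊆ U y₀ ∪ U y₁ := by
    intro p hp
    have hpC : (p, y) ∉ Core G T₁ T₂ := fun hC =>
      hyY ⟨p, hT₁.treeConvex_seg a b c₀ hc₀ c₁ hc₁ hp, hC⟩
    obtain ⟨δ₁, δ₂, h₁, h₂, hp₁, hp₂, hQ⟩ := notMem_core_iff.1 hpC
    by_cases hy₀ : y₀ ∈ δ₂
    · exact Or.inl ⟨δ₁, ⟨h₁, δ₂, h₂, hp₂, hy₀, hQ⟩, hp₁⟩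
    · by_cases hy₁ : y₁ ∈ δ₂
      · exact Or.inr ⟨δ₁, ⟨h₁, δ₂, h₂, hp₂, hy₁, hQ⟩, hp₁⟩
      · exact absurd hp₂ (h₂.treeConvex_compl hT₂ y₀ hy₀ y₁ hy₁ hy)
  have hout {v : T₂} {c : T₁} (hC : (c, v) ∈ Core G T₁ T₂) : c ∉ U v := by
    rintro ⟨δ₁, ⟨h₁, δ₂, h₂, -, hv, hQ⟩, hc⟩
    exact not_mem_direction_of_mem_core h₁ h₂ hQ hC ⟨hc, hv⟩
  obtain ⟨p, hp, ⟨δ₁, ⟨h₁, δ₂, h₂, hyδ, hy₀, hQ⟩, hpδ⟩,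
      ⟨δ₁', ⟨h₁', δ₂', h₂', hyδ', hy₁, hQ'⟩, hpδ'⟩⟩ :=
    hT₁.isPreconnected_seg c₀ c₁ (U y₀) (U y₁) (hU y₀) (hU y₁) hcover
      ⟨c₁, right_mem_seg c₀ c₁, (hcover (right_mem_seg c₀ c₁)).resolve_right (hout hC₁)⟩
      ⟨c₀, left_mem_seg c₀ c₁, (hcover (left_mem_seg c₀ c₁)).resolve_left (hout hC₀)⟩
  have hc₀ : c₀ ∉ δ₁ := fun hc => not_mem_direction_of_mem_core h₁ h₂ hQ hC₀ ⟨hc, hy₀⟩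
  have hc₁ : c₁ ∉ δ₁' := fun hc => not_mem_direction_of_mem_core h₁' h₂' hQ' hC₁ ⟨hc, hy₁⟩
  have hy₁' : y₁ ∉ δ₂ := fun hv =>
    h₁.treeConvex_compl hT₁ c₀ hc₀ c₁
      (fun hc => not_mem_direction_of_mem_core h₁ h₂ hQ hC₁ ⟨hc, hv⟩) hp hpδ
  have hy₀' : y₀ ∉ δ₂' := fun hv =>
    h₁'.treeConvex_compl hT₁ c₀
      (fun hc => not_mem_direction_of_mem_core h₁' h₂' hQ' hC₀ ⟨hc, hv⟩) c₁ hc₁ hp hpδ'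
  have hf₁ := facingDirections_of_mem_seg hT₁ h₁ h₁' hpδ hpδ' hp hc₀ hc₁
  have hf₂ := facingDirections_of_mem_seg hT₂ h₂ h₂' hyδ hyδ' (seg_comm y₀ y₁ ▸ hy) hy₁' hy₀'
  obtain ⟨x₁, hx₁⟩ := h₁
  obtain ⟨x₂, hx₂⟩ := h₂
  obtain ⟨x₁', hx₁'⟩ := h₁'
  obtain ⟨x₂', hx₂'⟩ := h₂'
  exact h ⟨(x₁, x₂), (x₁', x₂'), δ₁, δ₂, δ₁', δ₂', hx₁, hx₂, hx₁', hx₂', hf₁.ne hx₁ hx₁',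
    hf₂.ne hx₂ hx₂', hf₁, hf₂, hQ, hQ'⟩

/-- A compact set with preconnected image and preconnected fibers is preconnected. -/
theorem isPreconnected_of_image_of_fibers {X Y : Type*} [TopologicalSpace X]
    [TopologicalSpace Y] [T2Space Y] {f : X → Y} (hf : Continuous f) {K : Set X}
    (hK : IsCompact K) (himage : IsPreconnected (f '' K))
    (hfiber : ∀ y, IsPreconnected (K ∩ f ⁻¹' {y})) : IsPreconnected K := by
  rw [isPreconnected_closed_iff] at himage ⊢
  rintro A B hA hB hKAB ⟨x₁, hx₁, hx₁A⟩ ⟨x₂, hx₂, hx₂B⟩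
  obtain ⟨_, -, ⟨u, ⟨hu, huA⟩, rfl⟩, ⟨v, ⟨hv, hvB⟩, hvu⟩⟩ :=
    himage (f '' (K ∩ A)) (f '' (K ∩ B)) ((hK.inter_right hA).image hf).isClosed
      ((hK.inter_right hB).image hf).isClosed
      (by rw [← image_union, ← inter_union_distrib_left]
          exact image_mono (subset_inter Subset.rfl hKAB))
      ⟨f x₁, mem_image_of_mem f hx₁, x₁, ⟨hx₁, hx₁A⟩, rfl⟩
      ⟨f x₂, mem_image_of_mem f hx₂, x₂, ⟨hx₂, hx₂B⟩, rfl⟩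
  obtain ⟨w, hw, hwAB⟩ := isPreconnected_closed_iff.1 (hfiber (f u)) A B hA hB
    (inter_subset_left.trans hKAB) ⟨u, ⟨hu, rfl⟩, huA⟩ ⟨v, ⟨hv, hvu⟩, hvB⟩
  exact ⟨w, hw.1, hwAB⟩

theorem TreeConvex.inter {T : Type*} [MetricSpace T] {S S' : Set T} (hS : TreeConvex S)
    (hS' : TreeConvex S') : TreeConvex (S ∩ S') :=
  fun x hx y hy => subset_inter (hS x hx.1 y hy.1) (hS' x hx.2 y hy.2)

theorem isPreconnected_core_inter_rect (hT₁ : IsRTree T₁) (hT₂ : IsRTree T₂)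
    (h : ¬ ∃ x x' : T₁ × T₂, IsTwiceLightRect G x x') (a₁ b₁ : T₁) (a₂ b₂ : T₂) :
    IsPreconnected (Core G T₁ T₂ ∩ (seg a₁ b₁ ×ˢ seg a₂ b₂)) := by
  refine isPreconnected_of_image_of_fibers continuous_snd
    (((hT₁.isCompact_seg a₁ b₁).prod (hT₂.isCompact_seg a₂ b₂)).inter_left
      (isClosed_core hT₁ hT₂)) ?_ fun y => ?_
  · convert ((treeConvex_snd_core hT₁ hT₂ h a₁ b₁).inter
      (hT₂.treeConvex_seg a₂ b₂)).isPreconnected hT₂ using 1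
    ext y
    constructor
    · rintro ⟨z, ⟨hz, hz₁, hz₂⟩, rfl⟩
      exact ⟨⟨z.1, hz₁, hz⟩, hz₂⟩
    · rintro ⟨⟨x, hx, hC⟩, hy⟩
      exact ⟨(x, y), ⟨hC, hx, hy⟩, rfl⟩
  · by_cases hy : y ∈ seg a₂ b₂
    · convert (((treeConvex_core_fiber (G := G) hT₁ y).inter
        (hT₁.treeConvex_seg a₁ b₁)).isPreconnected hT₁).image (fun x => (x, y))
        (by fun_prop) using 1
      ext z
      constructor
      · rintro ⟨⟨hz, hz₁, -⟩, rfl⟩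
        exact ⟨z.1, ⟨hz, hz₁⟩, rfl⟩
      · rintro ⟨x, ⟨hC, hx⟩, rfl⟩
        exact ⟨⟨hC, hx, hy⟩, rfl⟩
    · convert isPreconnected_empty
      refine eq_empty_of_forall_notMem ?_
      rintro z ⟨⟨-, -, hz₂⟩, rfl⟩
      exact hy hz₂

end Core

/-- Proposition 4.7: under dense minimal subtrees and non-empty core,
the core is connected iff there is no twice-light rectangle; in this case the trace of
the core on every rectangle is empty or connected. -/
theorem core_connected_iff_no_twice_light
    {G T₁ T₂ : Type*} [Group G] [MetricSpace T₁] [MetricSpace T₂]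
    [MulAction G T₁] [MulAction G T₂]
    (hT₁ : IsRTree T₁) (hT₂ : IsRTree T₂)
    (hiso₁ : IsometricAction G T₁) (hiso₂ : IsometricAction G T₂)
    (hnt₁ : NontrivialAction G T₁) (hnt₂ : NontrivialAction G T₂)
    (hdense₁ : Dense (minSubtree G T₁)) (hdense₂ : Dense (minSubtree G T₂))
    (hne : (Core G T₁ T₂).Nonempty) :
    (IsConnected (Core G T₁ T₂) ↔ ¬ ∃ x x' : T₁ × T₂, IsTwiceLightRect G x x') ∧
    ((¬ ∃ x x' : T₁ × T₂, IsTwiceLightRect G x x') →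
      ∀ (a₁ b₁ : T₁) (a₂ b₂ : T₂),
        Core G T₁ T₂ ∩ (seg a₁ b₁ ×ˢ seg a₂ b₂) = ∅ ∨
        IsConnected (Core G T₁ T₂ ∩ (seg a₁ b₁ ×ˢ seg a₂ b₂))) := by
  refine ⟨⟨fun hC ⟨x, x', hx⟩ => not_isPreconnected_core_of_twiceLight hT₁ hiso₁ hiso₂
    hdense₁ hne hx hC.isPreconnected, fun h => ⟨hne, ?_⟩⟩, fun h a₁ b₁ a₂ b₂ => ?_⟩
  · exact isPreconnected_of_forall_pair fun p hp q hq =>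
      ⟨Core G T₁ T₂ ∩ (seg p.1 q.1 ×ˢ seg p.2 q.2), inter_subset_left, ⟨hp, left_mem_seg p.1 q.1, left_mem_seg p.2 q.2⟩,
        ⟨hq, right_mem_seg p.1 q.1, right_mem_seg p.2 q.2⟩,
        isPreconnected_core_inter_rect hT₁ hT₂ h _ _ _ _⟩
  · exact (eq_empty_or_nonempty _).imp_right fun hR =>
      ⟨hR, isPreconnected_core_inter_rect hT₁ hT₂ h a₁ b₁ a₂ b₂⟩

end Guirardel
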